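/- Let M ≥ 2 and k ≥ 3 be integers such that the critical strip S_M^k exists, i.e. q_{M+1}·k + (M+2)·log 3 < q_M·k − (M+1)·log 3. Then for every integer j ≥ 1, the set of complex numbers s with iteratedDeriv k riemannZeta s = 0, q_M·k − (M+1)·log 3 ≤ Re(s) ≤ q_M·k + (M+1)·log 3, and 0 < Im(s) ≤ 2πj/(log(M+1) − log M) is finite and has exactly j elements. -/

import Mathlib

/-- `q M = log(log M / log(M+1)) / log(M/(M+1))`, the slope of the `M`-th critical line. -/
noncomputable def q (M : ℕ) : ℝ :=
  Real.log (Real.log M / Real.log ((M : ℝ) + 1)) / Real.log ((M : ℝ) / ((M : ℝ) + 1))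

open Metric Set in
lemma fp_aux (r R : ℝ) (hr : 0 ≤ r) (hrR : r < R) (G : ℂ → ℂ)
    (hd : DifferentiableOn ℂ G (ball 0 R)) (hG : ∀ u ∈ ball (0:ℂ) R, ‖G u‖ ≤ r)
    (ε : ℝ) (hε : 0 ≤ ε) (hε2 : r + ε * (2 * r) < R) (n : ℕ) :
    ∀ x ∈ ball (0:ℂ) R, ∃ g : ℂ → ℂ, DifferentiableOn ℂ g (ball 0 R) ∧
      MapsTo g (ball 0 R) (ball 0 R) ∧ deriv g x = ((1 + ε : ℝ) : ℂ) ^ n * deriv (G^[n]) x := by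
  have hm : MapsTo G (ball 0 R) (ball 0 R) := fun u hu => by
    rw [mem_ball_zero_iff]; exact lt_of_le_of_lt (hG u hu) hrR
  induction n with
  | zero => 
    intro x hx
    exact ⟨id, differentiableOn_id, mapsTo_id _, by simp⟩
  | succ n ih =>
    intro x hx
    obtain ⟨g, hg1, hg2, hg3⟩ := ih (G x) (hm hx)
    have hψ : MapsTo (fun z => G z + ε * (G z - G x)) (ball 0 R) (ball 0 R) := by
      intro z hz
      rw [mem_ball_zero_iff]
      calc ‖G z + ε * (G z - G x)‖ ≤ ‖G z‖ + ‖(ε:ℂ) * (G z - G x)‖ := norm_add_le _ _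
        _ ≤ r + ε * (2 * r) := by
          rw [norm_mul, Complex.norm_real, Real.norm_of_nonneg hε]
          have := norm_sub_le (G z) (G x)
          have := hG z hz
          have := hG x hx
          gcongr
          linarith
        _ < R := hε2
    have hψd : DifferentiableOn ℂ (fun z => G z + ε * (G z - G x)) (ball 0 R) := by
      fun_prop
    have hGx : DifferentiableAt ℂ G x := hd.differentiableAt (isOpen_ball.mem_nhds hx)
    have hgx : DifferentiableAt ℂ g (G x) := hg1.differentiableAt (isOpen_ball.mem_nhds (hm hx))
    have hit : DifferentiableAt ℂ (G^[n]) (G x) := 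
      (hd.iterate hm n).differentiableAt (isOpen_ball.mem_nhds (hm hx))
    refine ⟨g ∘ (fun z => G z + ε * (G z - G x)), hg1.comp hψd hψ, hg2.comp hψ, ?_⟩
    have h1 : HasDerivAt (fun z => G z + ε * (G z - G x)) (deriv G x + ε * deriv G x) x :=
      hGx.hasDerivAt.add ((hGx.hasDerivAt.sub_const (G x)).const_mul (ε:ℂ))
    have h2 : HasDerivAt g (deriv g (G x)) ((fun z => G z + ε * (G z - G x)) x) := by
      simpa using hgx.hasDerivAt
    rw [(h2.comp x h1).deriv, hg3, Function.iterate_succ, deriv_comp x hit hGx]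
    push_cast
    ring

open Metric Set in
lemma fp (r R : ℝ) (hr : 0 ≤ r) (hrR : r < R) (G : ℂ → ℂ)
    (hd : DifferentiableOn ℂ G (ball 0 R)) (hG : ∀ u ∈ ball (0:ℂ) R, ‖G u‖ ≤ r) :
    ∃ u, ‖u‖ ≤ r ∧ G u = u ∧ ∀ v ∈ ball (0:ℂ) R, G v = v → v = u := by
  have hm : MapsTo G (ball 0 R) (ball 0 R) := fun u hu => by
    rw [mem_ball_zero_iff]; exact lt_of_le_of_lt (hG u hu) hrR
  have hsub : closedBall (0:ℂ) r ⊆ ball 0 R := closedBall_subset_ball hrR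
  have hmK : MapsTo G (closedBall 0 r) (closedBall 0 r) := fun u hu => by
    rw [mem_closedBall_zero_iff]; exact hG u (hsub hu)
  set ε := (R - r) / (2 * r + 1) with hεd
  have hε : 0 < ε := div_pos (by linarith) (by linarith)
  have hε2 : r + ε * (2 * r) < R := by
    have : ε * (2 * r + 1) = R - r := by rw [hεd]; field_simp
    nlinarith
  set δ := (R - r) / 2 with hδ
  have hδ0 : 0 < δ := by rw [hδ]; linarith
  obtain ⟨n, hn⟩ := pow_unbounded_of_one_lt (2 * (R / δ)) (by linarith : 1 < 1 + ε)
  have hbound : ∀ x ∈ closedBall (0:ℂ) r, ‖deriv (G^[n]) x‖ ≤ 1 / 2 := by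
    intro x hx
    obtain ⟨g, hg1, hg2, hg3⟩ := fp_aux r R hr hrR G hd hG ε hε.le hε2 n x (hsub hx)
    have hcb : closedBall x δ ⊆ ball 0 R := by
      intro y hy
      rw [mem_closedBall_zero_iff] at hx
      rw [mem_closedBall, dist_eq_norm] at hy
      rw [mem_ball_zero_iff]
      have : ‖y‖ ≤ ‖x‖ + ‖y - x‖ := by
        have := norm_add_le x (y - x); simpa using this
      linarith
    have hc : ‖deriv g x‖ ≤ R / δ := by
      apply Complex.norm_deriv_le_of_forall_mem_sphere_norm_le hδ0
      · apply DifferentiableOn.diffContOnCl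
        rw [closure_ball x hδ0.ne']
        exact hg1.mono hcb
      · intro z hz
        have := hg2 (hcb (sphere_subset_closedBall hz))
        rw [mem_ball_zero_iff] at this
        exact this.le
    rw [hg3, norm_mul, norm_pow, Complex.norm_real, Real.norm_of_nonneg (by linarith)] at hc
    by_contra! hcon
    have h0 : 0 < (1 + ε) ^ n := by positivity
    nlinarith
  have hlip : LipschitzOnWith (1/2) (G^[n]) (closedBall 0 r) := by
    apply Convex.lipschitzOnWith_of_nnnorm_deriv_le (𝕜 := ℂ) _ _ (convex_closedBall 0 r)
    · intro x hx
      exact (hd.iterate hm n).differentiableAt (isOpen_ball.mem_nhds (hsub hx))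
    · intro x hx
      rw [← NNReal.coe_le_coe]
      simpa using hbound x hx
  have huniq : ∀ u ∈ closedBall (0:ℂ) r, ∀ v ∈ closedBall (0:ℂ) r, G^[n] u = u → G^[n] v = v → u = v := by
    intro u hu v hv h1 h2
    have := hlip.dist_le_mul u hu v hv
    rw [h1, h2] at this
    have h3 := dist_nonneg (x := u) (y := v)
    apply dist_le_zero.mp
    push_cast at this
    linarith
  have hmn := hmK.iterate n
  have hcon : ContractingWith (1/2) (hmn.restrict (G^[n]) _ _) := by
    refine ⟨?_, ?_⟩
    · rw [← NNReal.coe_lt_coe]; push_cast; norm_num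
    · exact hlip.mapsToRestrict hmn
  obtain ⟨y, hy, hfy, -⟩ := hcon.exists_fixedPoint' (isClosed_closedBall.isComplete) hmn
    (x := 0) (by simpa using hr) (edist_ne_top _ _)
  have hGy : G y = y := by
    apply huniq _ (hmK hy) _ hy _ hfy
    rw [← Function.iterate_succ_apply, Function.iterate_succ_apply', hfy]
  refine ⟨y, by simpa using hy, hGy, ?_⟩
  intro v hv h
  have hvK : v ∈ closedBall (0:ℂ) r := by
    rw [mem_closedBall_zero_iff, ← h]; exact hG v hv
  exact huniq v hvK y hy (Function.iterate_fixed h n) hfy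

lemma log_pos_nat (n : ℕ) (hn : 2 ≤ n) : 0 < Real.log n :=
  Real.log_pos (by exact_mod_cast (by omega : 1 < n))

lemma log_lt_succ (n : ℕ) (hn : 2 ≤ n) : Real.log n < Real.log ((n:ℝ) + 1) :=
  Real.log_lt_log (by positivity) (by linarith)

lemma q_mul (n : ℕ) (hn : 2 ≤ n) :
    q n * (Real.log ((n:ℝ) + 1) - Real.log n) =
      Real.log (Real.log ((n:ℝ) + 1)) - Real.log (Real.log n) := by
  have h1 := log_pos_nat n hn
  have h2 := log_lt_succ n hn
  unfold q
  rw [Real.log_div h1.ne' (by linarith), Real.log_div (by positivity) (by positivity)]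
  have : Real.log n - Real.log ((n:ℝ)+1) ≠ 0 := by linarith
  field_simp
  ring

lemma q_int (n : ℕ) (hn : 2 ≤ n) :
    q n = ∫ t in (0:ℝ)..1, 1 / ((1 - t) * Real.log n + t * Real.log ((n:ℝ) + 1)) := by
  have h1 := log_pos_nat n hn
  have h2 := log_lt_succ n hn
  set a := Real.log n
  set b := Real.log ((n:ℝ)+1)
  have hpos : ∀ t ∈ Set.uIcc (0:ℝ) 1, 0 < (1 - t) * a + t * b := by
    intro t ht
    rw [Set.uIcc_of_le zero_le_one] at ht
    obtain ⟨h0, h1'⟩ := ht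
    nlinarith
  have hder : ∀ t ∈ Set.uIcc (0:ℝ) 1,
      HasDerivAt (fun t => Real.log ((1 - t) * a + t * b) / (b - a)) (1 / ((1 - t) * a + t * b)) t := by
    intro t ht
    have h3 : HasDerivAt (fun t : ℝ => (1 - t) * a + t * b) (b - a) t := by
      have := (((hasDerivAt_id t).const_sub 1).mul_const a).add ((hasDerivAt_id t).mul_const b)
      convert! this using 1
      ring
    have h4 := (h3.log (hpos t ht).ne').div_const (b - a)
    convert! h4 using 1
    have := hpos t ht
    have : b - a ≠ 0 := by linarith
    field_simp
  have hcont : ContinuousOn (fun t => 1 / ((1 - t) * a + t * b)) (Set.uIcc (0:ℝ) 1) := by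
    apply ContinuousOn.div (by fun_prop) (by fun_prop)
    intro t ht
    exact (hpos t ht).ne'
  rw [intervalIntegral.integral_eq_sub_of_hasDerivAt hder hcont.intervalIntegrable]
  have := q_mul n hn
  have h5 : b - a ≠ 0 := by linarith
  field_simp
  rw [this]
  simp [a, b]

lemma q_integrable (n : ℕ) (hn : 2 ≤ n) :
    IntervalIntegrable (fun t => 1 / ((1 - t) * Real.log n + t * Real.log ((n:ℝ) + 1)))
      MeasureTheory.volume 0 1 := by
  have h1 := log_pos_nat n hn
  have h2 := log_lt_succ n hn
  apply ContinuousOn.intervalIntegrable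
  apply ContinuousOn.div (by fun_prop) (by fun_prop)
  intro t ht
  rw [Set.uIcc_of_le zero_le_one] at ht
  obtain ⟨h0, h1'⟩ := ht
  have : 0 < (1 - t) * Real.log n + t * Real.log ((n:ℝ) + 1) := by nlinarith
  exact this.ne'

lemma q_pos (n : ℕ) (hn : 2 ≤ n) : 0 < q n := by
  have h1 := log_pos_nat n hn
  have h2 := log_lt_succ n hn
  have h3 := Real.log_lt_log h1 h2
  have h4 := q_mul n hn
  by_contra! h
  nlinarith

lemma q_anti (n : ℕ) (hn : 2 ≤ n) : q (n + 1) ≤ q n := by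
  have h1 := log_pos_nat n hn
  have h2 := log_lt_succ n hn
  have h3 := log_lt_succ (n + 1) (by omega)
  push_cast at h3
  rw [q_int n hn, q_int (n+1) (by omega)]
  apply intervalIntegral.integral_mono_on zero_le_one (q_integrable _ (by omega)) (q_integrable _ hn)
  intro t ⟨h0, h1'⟩
  push_cast
  apply one_div_le_one_div_of_le
  · nlinarith
  · nlinarith

lemma log_concave_nat (n : ℕ) (hn : 1 ≤ n) :
    Real.log n + Real.log ((n:ℝ) + 1 + 1) ≤ 2 * Real.log ((n:ℝ) + 1) := by
  have : (0:ℝ) < n := by exact_mod_cast hn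
  rw [← Real.log_mul (by positivity) (by positivity), two_mul, ← Real.log_mul (by positivity) (by positivity)]
  apply Real.log_le_log (by positivity)
  nlinarith

lemma q_convex (n : ℕ) (hn : 2 ≤ n) : 2 * q (n + 1) ≤ q n + q (n + 2) := by
  have h1 := log_pos_nat n hn
  have h2 := log_lt_succ n hn
  have h3 := log_lt_succ (n + 1) (by omega)
  have h4 := log_lt_succ (n + 2) (by omega)
  have c1 := log_concave_nat n (by omega)
  have c2 := log_concave_nat (n + 1) (by omega)
  rw [q_int n hn, q_int (n+1) (by omega), q_int (n+2) (by omega),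
    ← intervalIntegral.integral_add (q_integrable _ hn) (q_integrable _ (by omega)),
    ← intervalIntegral.integral_const_mul]
  apply intervalIntegral.integral_mono_on zero_le_one ((q_integrable _ (by omega)).const_mul 2)
    ((q_integrable _ hn).add (q_integrable _ (by omega)))
  intro t ⟨h0, h1'⟩
  have e : ((n + 2 : ℕ) : ℝ) = (n:ℝ) + 1 + 1 := by push_cast; ring
  rw [e] at h4 ⊢
  push_cast at h3 h4 c2 ⊢
  set a := Real.log n
  set b := Real.log ((n:ℝ) + 1)
  set c := Real.log ((n:ℝ) + 1 + 1)
  set d := Real.log ((n:ℝ) + 1 + 1 + 1)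
  have p1 : 0 < (1 - t) * a + t * b := by nlinarith
  have p2 : 0 < (1 - t) * b + t * c := by nlinarith
  have p3 : 0 < (1 - t) * c + t * d := by nlinarith
  have p4 : ((1 - t) * a + t * b) + ((1 - t) * c + t * d) ≤ 2 * ((1 - t) * b + t * c) := by nlinarith
  generalize (1 - t) * a + t * b = x at *
  generalize (1 - t) * b + t * c = y at *
  generalize (1 - t) * c + t * d = z at *
  have : 1 / x + 1 / z ≥ 4 / (x + z) := by
    rw [ge_iff_le, div_add_div _ _ p1.ne' p3.ne', div_le_div_iff₀ (by positivity) (by positivity)]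
    nlinarith [sq_nonneg (x - z)]
  have h6 : 4 / (x + z) ≥ 2 * (1 / y) := by
    rw [ge_iff_le, mul_one_div, div_le_div_iff₀ (by positivity) (by positivity)]
    nlinarith
  linarith

/-- real term -/
noncomputable def aa (k : ℕ) (τ : ℝ) (n : ℕ) : ℝ := Real.log n ^ k * (n:ℝ) ^ (-τ)

lemma aa_eq (k : ℕ) (τ : ℝ) (n : ℕ) (hn : 2 ≤ n) :
    aa k τ n = Real.exp (k * Real.log (Real.log n) - τ * Real.log n) := by
  have h1 := log_pos_nat n hn
  unfold aa
  rw [sub_eq_add_neg, Real.exp_add, Real.rpow_def_of_pos (by positivity)]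
  congr 1
  · rw [mul_comm, Real.exp_mul, Real.exp_log h1, Real.rpow_natCast]
  · congr 1; ring

lemma aa_pos (k : ℕ) (τ : ℝ) (n : ℕ) (hn : 2 ≤ n) : 0 < aa k τ n := by
  rw [aa_eq k τ n hn]; exact Real.exp_pos _

lemma aa_succ (k : ℕ) (τ : ℝ) (n : ℕ) (hn : 2 ≤ n) :
    aa k τ (n + 1) = aa k τ n * Real.exp ((q n * k - τ) * (Real.log ((n:ℝ) + 1) - Real.log n)) := by
  rw [aa_eq k τ n hn, aa_eq k τ (n+1) (by omega), ← Real.exp_add]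
  congr 1
  have := q_mul n hn
  push_cast
  linear_combination (-(k:ℝ)) * this

lemma aa_shift (k : ℕ) (σ c : ℝ) (n : ℕ) (hn : 2 ≤ n) :
    aa k σ n = aa k (σ + c) n * (n:ℝ) ^ c := by
  have : (0:ℝ) < n := by positivity
  unfold aa
  rw [mul_assoc, ← Real.rpow_add this]
  congr 2; ring

lemma q_anti' (n m : ℕ) (hn : 2 ≤ n) (h : n ≤ m) : q m ≤ q n := by
  induction m, h using Nat.le_induction with
  | base => exact le_rfl
  | succ m hm ih => exact (q_anti m (by omega)).trans ih

/-- head bound per term -/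
lemma head_term (k : ℕ) (σ c : ℝ) (M : ℕ) (hc : 0 ≤ c) 
    (hσ : σ + c ≤ q (M - 1) * k) (n : ℕ) (hn : 2 ≤ n) (hnM : n ≤ M) :
    aa k σ n ≤ aa k σ M * Real.exp (-(c / M)) ^ (M - n) := by
  have hmono : ∀ m, n ≤ m → m ≤ M → aa k (σ + c) n ≤ aa k (σ + c) m := by
    intro m hm
    induction m, hm using Nat.le_induction with
    | base => intro _; exact le_rfl
    | succ m hm ih =>
      intro hmM
      refine (ih (by omega)).trans ?_
      rw [aa_succ _ _ m (by omega)]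
      apply le_mul_of_one_le_right (aa_pos _ _ _ (by omega)).le
      apply Real.one_le_exp
      have h1 := q_anti' m (M-1) (by omega) (by omega)
      have h2 := log_lt_succ m (by omega)
      have h3 : q (M - 1) * k ≤ q m * k := by gcongr
      apply mul_nonneg <;> linarith
  have h := hmono M hnM le_rfl
  have hn0 : (0:ℝ) < n := by positivity
  have hM0 : (0:ℝ) < M := by exact_mod_cast (by omega : 0 < M)
  rw [aa_shift k σ c n hn, aa_shift k σ c M (by omega), mul_assoc]
  have hx : (n:ℝ) ^ c ≤ (M:ℝ) ^ c * Real.exp (-(c / M)) ^ (M - n) := by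
    rw [Real.rpow_def_of_pos hn0, Real.rpow_def_of_pos hM0, ← Real.exp_nat_mul, ← Real.exp_add]
    apply Real.exp_le_exp.mpr
    have h5 := Real.log_le_sub_one_of_pos (div_pos hn0 hM0)
    rw [Real.log_div hn0.ne' hM0.ne'] at h5
    rw [Nat.cast_sub hnM]
    have h6 : (Real.log n - Real.log M) * c ≤ ((n:ℝ)/M - 1) * c := by gcongr
    have h7 : ((n:ℝ)/M - 1) * c = ((M:ℝ) - n) * -(c/M) := by field_simp; ring
    linarith
  have := aa_pos k (σ + c) n hn
  have := aa_pos k (σ + c) M (by omega)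
  gcongr

lemma head_sum (k : ℕ) (hk : 3 ≤ k) (σ c ρ : ℝ) (M : ℕ) (hM : 2 ≤ M) (hc : 0 ≤ c) 
    (hσ : 3 ≤ M → σ + c ≤ q (M - 1) * k) (hρ : Real.exp (-(c / M)) ≤ ρ) (hρ1 : ρ < 1) :
    ∑ n ∈ Finset.range M, aa k σ n ≤ aa k σ M * (ρ / (1 - ρ)) := by
  have hρ0 : 0 ≤ ρ := (Real.exp_pos _).le.trans hρ
  have hpos := aa_pos k σ M hM
  have h1 : ∀ n ∈ Finset.range M, aa k σ n ≤ aa k σ M * ρ ^ (M - n) := by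
    intro n hn
    rw [Finset.mem_range] at hn
    by_cases h2 : 2 ≤ n
    · refine (head_term k σ c M hc (hσ (by omega)) n h2 hn.le).trans ?_
      gcongr
    · have hk0 : k ≠ 0 := by omega
      have : aa k σ n = 0 := by
        have : n = 0 ∨ n = 1 := by omega
        rcases this with rfl | rfl <;> simp [aa, hk0]
      rw [this]; positivity
  refine (Finset.sum_le_sum h1).trans ?_
  rw [← Finset.mul_sum]
  gcongr
  have h3 : ∑ n ∈ Finset.range M, ρ ^ (M - n) = ∑ n ∈ Finset.range M, ρ ^ (n + 1) := by
    rw [← Finset.sum_range_reflect]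
    apply Finset.sum_congr rfl
    intro n hn
    rw [Finset.mem_range] at hn
    congr 1; omega
  rw [h3, le_div_iff₀ (by linarith)]
  have h4 := geom_sum_mul_neg ρ M
  simp only [pow_succ]
  rw [← Finset.sum_mul]
  have h5 : 0 ≤ ρ ^ M := by positivity
  nlinarith

lemma tail_term (k : ℕ) (σ c : ℝ) (N : ℕ) (hN : 2 ≤ N) (hσ : q N * k + c ≤ σ) (n : ℕ) (hn : N ≤ n) :
    aa k σ n ≤ aa k σ N * ((N:ℝ) / n) ^ c := by
  have hmono : aa k (σ + -c) n ≤ aa k (σ + -c) N := by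
    induction n, hn using Nat.le_induction with
    | base => exact le_rfl
    | succ m hm ih =>
      refine le_trans ?_ ih
      rw [aa_succ _ _ m (by omega)]
      apply mul_le_of_le_one_right (aa_pos _ _ _ (by omega)).le
      apply Real.exp_le_one_iff.mpr
      have h1 := q_anti' N m (by omega) (by omega)
      have h2 := log_lt_succ m (by omega)
      have h3 : q m * k ≤ q N * k := by gcongr
      apply mul_nonpos_of_nonpos_of_nonneg <;> linarith
  have hn0 : (0:ℝ) < n := by exact_mod_cast (by omega : 0 < n)
  have hN0 : (0:ℝ) < N := by positivity
  rw [aa_shift k σ (-c) n (by omega), aa_shift k σ (-c) N (by omega), mul_assoc,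
    Real.div_rpow hN0.le hn0.le, Real.rpow_neg hN0.le, Real.rpow_neg hn0.le]
  have : 0 < (N:ℝ) ^ c := by positivity
  have : 0 < (n:ℝ) ^ c := by positivity
  have e : ((N:ℝ) ^ c)⁻¹ * ((N:ℝ) ^ c / (n:ℝ) ^ c) = ((n:ℝ) ^ c)⁻¹ := by field_simp
  rw [e]
  gcongr

lemma pow_sum (p c : ℝ) (hp : 1 ≤ p) (hc : 1 < c) (m : ℕ) :
    ∑ i ∈ Finset.range m, (p / (p + i + 1)) ^ c ≤ (p - (p + m) * (p / (p + m)) ^ c) / (c - 1) := by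
  induction m with
  | zero => simp [div_self (by linarith : p ≠ 0)]
  | succ m ih =>
    rw [Finset.sum_range_succ]
    have hx : 0 < p + m := by positivity
    have hy : 0 < p + m + 1 := by positivity
    have key : (c - 1) * (p / (p + m + 1)) ^ c ≤ (p + m) * (p / (p + m)) ^ c - (p + m + 1) * (p / (p + m + 1)) ^ c := by
      set x := p + m
      have h1 : (p / x) ^ c = (p / (x + 1)) ^ c * ((x + 1) / x) ^ c := by
        rw [← Real.mul_rpow (by positivity) (by positivity)]
        congr 1
        field_simp
      have h2 : x * ((x + 1) / x) ^ c ≥ x + 1 + (c - 1) := by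
        have h3 : ((x + 1) / x) ^ c = ((x+1)/x) * ((x+1)/x) ^ (c - 1) := by
          have : 0 < (x + 1) / x := by positivity
          nth_rewrite 2 [← Real.rpow_one ((x+1)/x)]
          rw [← Real.rpow_add this]; congr 1; ring
        have h4 : ((x+1)/x) ^ (c - 1) ≥ 1 + (c - 1) / (x + 1) := by
          rw [Real.rpow_def_of_pos (by positivity)]
          have h5 := Real.add_one_le_exp (Real.log ((x+1)/x) * (c-1))
          have h6 := Real.one_sub_inv_le_log_of_pos (by positivity : 0 < (x+1)/x)
          have h7 : 1 - ((x+1)/x)⁻¹ = 1 / (x+1) := by field_simp; ring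
          rw [h7] at h6
          have h8 : 1 / (x+1) * (c - 1) ≤ Real.log ((x+1)/x) * (c-1) := by
            have : 0 ≤ c - 1 := by linarith
            gcongr
          have h9 : 1 / (x+1) * (c - 1) = (c-1)/(x+1) := by ring
          linarith
        rw [h3]
        calc x * ((x+1)/x * ((x+1)/x) ^ (c-1)) = (x+1) * ((x+1)/x) ^ (c-1) := by field_simp
          _ ≥ (x+1) * (1 + (c-1)/(x+1)) := by gcongr
          _ = _ := by field_simp
      rw [h1]
      have h0 : 0 < (p / (x + 1)) ^ c := by positivity
      nlinarith
    have e : p + ((m+1 : ℕ):ℝ) = p + m + 1 := by push_cast; ring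
    rw [e]
    have hc' : 0 < c - 1 := by linarith
    rw [le_div_iff₀ hc'] at ih ⊢
    nlinarith

lemma tail_sum (N : ℕ) (hN : 2 ≤ N) (c : ℝ) (hc : 1 < c) (m : ℕ) :
    ∑ i ∈ Finset.range m, ((N:ℝ) / (N + 1 + i : ℕ)) ^ c ≤
      ((N:ℝ) / (N + 1)) ^ c + ((N:ℝ) / (N + 2)) ^ c * (1 + (N + 2) / (c - 1)) := by
  have hN0 : (0:ℝ) < N := by positivity
  have h1 : ∑ i ∈ Finset.range m, ((N:ℝ) / (N + 1 + i : ℕ)) ^ c ≤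
      ∑ i ∈ Finset.range (m+2), ((N:ℝ) / (N + 1 + i : ℕ)) ^ c := by
    apply Finset.sum_le_sum_of_subset_of_nonneg
    · intro i; simp only [Finset.mem_range]; omega
    · intros; positivity
  refine h1.trans ?_
  rw [Finset.sum_range_succ', Finset.sum_range_succ']
  have h2 : ∀ i ∈ Finset.range m, ((N:ℝ) / (N + 1 + (i + 1 + 1) : ℕ)) ^ c = 
      ((N:ℝ) / (N + 2)) ^ c * (((N:ℝ) + 2) / ((N:ℝ) + 2 + i + 1)) ^ c := by
    intro i _
    rw [← Real.mul_rpow (by positivity) (by positivity)]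
    congr 1
    push_cast
    field_simp
    ring
  rw [Finset.sum_congr rfl h2, ← Finset.mul_sum]
  have h3 := pow_sum ((N:ℝ) + 2) c (by linarith) hc m
  have h4 : ((N:ℝ) + 2 - ((N:ℝ) + 2 + m) * (((N:ℝ) + 2) / ((N:ℝ) + 2 + m)) ^ c) / (c - 1) ≤ ((N:ℝ) + 2) / (c - 1) := by
    have : 0 ≤ c - 1 := by linarith
    gcongr
    have : 0 ≤ ((N:ℝ) + 2 + m) * (((N:ℝ) + 2) / ((N:ℝ) + 2 + m)) ^ c := by positivity
    linarith
  have h5 : 0 < ((N:ℝ) / (N + 2)) ^ c := by positivity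
  have h6 := mul_le_mul_of_nonneg_left (h3.trans h4) h5.le
  have e1 : ((N + 1 + (0 + 1) : ℕ) : ℝ) = N + 2 := by push_cast; ring
  have e2 : ((N + 1 + 0 : ℕ) : ℝ) = N + 1 := by push_cast; ring
  rw [e1, e2]
  linarith

lemma rpow_bound (N c d e : ℝ) (hN : 0 < N) (hd : 0 < d) (hc : 0 ≤ c)
    (h : e * (2 * N + d) ≤ 2 * d * c) : (N / (N + d)) ^ c ≤ Real.exp (-e) := by
  rw [Real.rpow_def_of_pos (by positivity)]
  apply Real.exp_le_exp.mpr
  have h1 := Real.le_log_one_add_of_nonneg (by positivity : 0 ≤ d / N)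
  have h2 : Real.log (N / (N + d)) = - Real.log (1 + d / N) := by
    rw [← Real.log_inv]; congr 1; field_simp
  have h3 : 2 * (d / N) / (d / N + 2) = 2 * d / (2 * N + d) := by field_simp; ring
  rw [h3] at h1
  rw [h2]
  have h4 : 2 * d / (2 * N + d) * c ≤ Real.log (1 + d / N) * c := by gcongr
  have h5 : e ≤ 2 * d / (2 * N + d) * c := by
    rw [div_mul_eq_mul_div, le_div_iff₀ (by positivity)]; linarith
  linarith

lemma exp_neg_log3 : Real.exp (-Real.log 3) = 1 / 3 := by
  rw [Real.exp_neg, Real.exp_log (by norm_num)]; norm_num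

lemma exp_neg_log3' : Real.exp (-(2 * Real.log 3)) = 1 / 9 := by
  rw [show -(2 * Real.log 3) = -Real.log 3 + -Real.log 3 by ring, Real.exp_add, exp_neg_log3]; norm_num

/-- left half tail -/
lemma tail_left (N : ℕ) (hN : 3 ≤ N) (m : ℕ) :
    ∑ i ∈ Finset.range m, ((N:ℝ) / (N + 1 + i : ℕ)) ^ (((N:ℝ) + 1) * Real.log 3) ≤ 13 / 21 := by
  have hl := Real.log_three_gt_d9
  have hN' : (3:ℝ) ≤ N := by exact_mod_cast hN
  refine (tail_sum N (by omega) _ (by nlinarith) m).trans ?_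
  have h1 := rpow_bound N (((N:ℝ) + 1) * Real.log 3) 1 (Real.log 3) (by linarith) one_pos (by nlinarith) (by nlinarith)
  have h2 := rpow_bound N (((N:ℝ) + 1) * Real.log 3) 2 (2 * Real.log 3) (by linarith) two_pos (by nlinarith) (by nlinarith)
  rw [exp_neg_log3] at h1
  rw [exp_neg_log3'] at h2
  have h3 : ((N:ℝ) + 2) / (((N:ℝ) + 1) * Real.log 3 - 1) ≤ 3 / 2 := by
    rw [div_le_iff₀ (by nlinarith)]; nlinarith
  have h4 : 0 ≤ ((N:ℝ) / (N + 2)) ^ (((N:ℝ) + 1) * Real.log 3) := by positivity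
  nlinarith

lemma tail_right (N : ℕ) (hN : 3 ≤ N) (m : ℕ) :
    ∑ i ∈ Finset.range m, ((N:ℝ) / (N + 1 + i : ℕ)) ^ ((2 * (N:ℝ) + 1) * Real.log 3) ≤ 1 / 3 := by
  have hl := Real.log_three_gt_d9
  have hN' : (3:ℝ) ≤ N := by exact_mod_cast hN
  refine (tail_sum N (by omega) _ (by nlinarith) m).trans ?_
  have h1 := rpow_bound N ((2 * (N:ℝ) + 1) * Real.log 3) 1 (2 * Real.log 3) (by linarith) one_pos (by nlinarith) (by nlinarith)
  have h2 := rpow_bound N ((2 * (N:ℝ) + 1) * Real.log 3) 2 (2 * Real.log 3) (by linarith) two_pos (by nlinarith) (by nlinarith)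
  rw [exp_neg_log3'] at h1
  rw [exp_neg_log3'] at h2
  have h3 : ((N:ℝ) + 2) / ((2 * (N:ℝ) + 1) * Real.log 3 - 1) ≤ 1 := by
    rw [div_le_iff₀ (by nlinarith)]; nlinarith
  have h4 : 0 ≤ ((N:ℝ) / (N + 2)) ^ ((2 * (N:ℝ) + 1) * Real.log 3) := by positivity
  nlinarith

lemma norm_log_le (z : ℂ) (hz : ‖z‖ < 1) : ‖Complex.log (1 + z)‖ ≤ -Real.log (1 - ‖z‖) := by
  have h1 := Complex.hasSum_taylorSeries_log hz
  have h2 := Real.hasSum_pow_div_log_of_abs_lt_one (x := ‖z‖) (by rwa [abs_norm])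
  have h3 : HasSum (fun n : ℕ => ‖z‖ ^ n / n) (-Real.log (1 - ‖z‖)) := by
    rw [← hasSum_nat_add_iff' 1]
    simpa using h2
  rw [← h1.tsum_eq]
  apply tsum_of_norm_bounded h3
  intro n
  simp

/-- complex term -/
noncomputable def AA (k n : ℕ) (s : ℂ) : ℂ := (Real.log n : ℂ) ^ k * (n:ℂ) ^ (-s)

lemma AA_norm (k n : ℕ) (hk : 3 ≤ k) (s : ℂ) : ‖AA k n s‖ = aa k s.re n := by
  have hk0 : k ≠ 0 := by omega
  rcases Nat.eq_zero_or_pos n with rfl | hn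
  · simp [AA, aa, hk0]
  · unfold AA aa
    rw [norm_mul, norm_pow, Complex.norm_real, Complex.norm_natCast_cpow_of_pos hn,
      Real.norm_of_nonneg (Real.log_natCast_nonneg n)]
    simp

lemma AA_ne (k n : ℕ) (hk : 3 ≤ k) (hn : 2 ≤ n) (s : ℂ) : AA k n s ≠ 0 := by
  rw [← norm_pos_iff, AA_norm k n hk]; exact aa_pos _ _ _ hn

lemma AA_diff (k n : ℕ) (hk : 3 ≤ k) : Differentiable ℂ (AA k n) := by
  have hk0 : k ≠ 0 := by omega
  rcases Nat.eq_zero_or_pos n with rfl | hn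
  · have : AA k 0 = fun _ => 0 := by funext s; simp [AA, hk0]
    rw [this]; fun_prop
  · have : (n:ℂ) ≠ 0 := by exact_mod_cast hn.ne'
    intro s
    unfold AA
    apply DifferentiableAt.const_mul
    exact differentiableAt_id.neg.const_cpow (Or.inl this)

lemma AA_eq (k n : ℕ) (hn : 2 ≤ n) (s : ℂ) :
    AA k n s = Complex.exp (k * (Real.log (Real.log n) : ℝ) - s * (Real.log n : ℝ)) := by
  have h1 := log_pos_nat n hn
  have h0 : (n:ℂ) ≠ 0 := by exact_mod_cast (by omega : n ≠ 0)
  unfold AA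
  rw [sub_eq_add_neg, Complex.exp_add, Complex.exp_nat_mul, ← Complex.ofReal_exp, Real.exp_log h1,
    Complex.cpow_def_of_ne_zero h0, Complex.natCast_log]
  congr 2; ring

lemma AA_succ (k n : ℕ) (hn : 2 ≤ n) (s : ℂ) :
    AA k (n + 1) s = AA k n s *
      Complex.exp (-(((Real.log ((n:ℝ) + 1) - Real.log n : ℝ) : ℂ) * (s - ((q n * k : ℝ) : ℂ)))) := by
  rw [AA_eq k n hn, AA_eq k (n+1) (by omega), ← Complex.exp_add]
  congr 1
  have := congrArg (fun x : ℝ => (x : ℂ)) (q_mul n hn)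
  push_cast at this ⊢
  linear_combination (-(k:ℂ)) * this

open LSeries in
lemma logMul_iter (k n : ℕ) : (logMul^[k] (1 : ℕ → ℂ)) n = (Real.log n : ℂ) ^ k := by
  induction k with
  | zero => simp
  | succ k ih =>
    rw [Function.iterate_succ_apply', logMul, ih, pow_succ, Complex.natCast_log]
    ring

lemma term_AA (k n : ℕ) (hk : 3 ≤ k) (s : ℂ) :
    LSeries.term (LSeries.logMul^[k] (1 : ℕ → ℂ)) s n = AA k n s := by
  have hk0 : k ≠ 0 := by omega
  rcases Nat.eq_zero_or_pos n with rfl | hn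
  · simp [AA, hk0]
  · rw [LSeries.term_of_ne_zero hn.ne', logMul_iter, AA, Complex.cpow_neg, div_eq_mul_inv]

noncomputable def FF (k : ℕ) (s : ℂ) : ℂ := LSeries (LSeries.logMul^[k] (1 : ℕ → ℂ)) s

lemma absc_lt (s : ℂ) (hs : 1 < s.re) : LSeries.abscissaOfAbsConv (1 : ℕ → ℂ) < s.re := by
  rw [LSeries.abscissaOfAbsConv_one]; exact_mod_cast hs

lemma FF_summable (k : ℕ) (hk : 3 ≤ k) (s : ℂ) (hs : 1 < s.re) : Summable (fun n => AA k n s) := by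
  have h : LSeriesSummable (LSeries.logMul^[k] (1 : ℕ → ℂ)) s := by
    apply LSeriesSummable_of_abscissaOfAbsConv_lt_re
    rw [LSeries.absicssaOfAbsConv_logPowMul]
    exact absc_lt s hs
  unfold LSeriesSummable at h
  exact h.congr (fun n => term_AA k n hk s)

lemma FF_eq (k : ℕ) (hk : 3 ≤ k) (s : ℂ) : FF k s = ∑' n, AA k n s := by
  unfold FF LSeries
  exact tsum_congr (fun n => term_AA k n hk s)

lemma FF_diff (k : ℕ) : DifferentiableOn ℂ (FF k) {s | 1 < s.re} := by
  apply (LSeries_differentiableOn _).mono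
  intro s hs
  rw [Set.mem_ofPred_eq, LSeries.absicssaOfAbsConv_logPowMul]
  exact absc_lt s hs

lemma zeta_FF (k : ℕ) (s : ℂ) (hs : 1 < s.re) :
    iteratedDeriv k riemannZeta s = (-1) ^ k * FF k s := by
  have hev : riemannZeta =ᶠ[nhds s] LSeries 1 := by
    have ho : IsOpen {s : ℂ | 1 < s.re} := isOpen_lt continuous_const Complex.continuous_re
    filter_upwards [ho.mem_nhds hs] with z hz
    exact (LSeries_one_eq_riemannZeta hz).symm
  rw [hev.iteratedDeriv_eq, LSeries_iteratedDeriv k (absc_lt s hs)]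
  rfl

lemma zeta_zero_iff (k : ℕ) (s : ℂ) (hs : 1 < s.re) :
    iteratedDeriv k riemannZeta s = 0 ↔ FF k s = 0 := by
  rw [zeta_FF k s hs]; simp

noncomputable def HH (M k : ℕ) (s : ℂ) : ℂ := (∑ n ∈ Finset.range M, AA k n s) / AA k M s

noncomputable def TT (M k : ℕ) (s : ℂ) : ℂ :=
  (FF k s - ∑ n ∈ Finset.range (M + 2), AA k n s) / AA k (M + 1) s

lemma HH_bound (M k : ℕ) (hM : 2 ≤ M) (hk : 3 ≤ k) (s : ℂ) (c ρ : ℝ) (hc : 0 ≤ c) 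
    (hσ : 3 ≤ M → s.re + c ≤ q (M - 1) * k) (hρ : Real.exp (-(c / M)) ≤ ρ) (hρ1 : ρ < 1) :
    ‖HH M k s‖ ≤ ρ / (1 - ρ) := by
  unfold HH
  have hp := aa_pos k s.re M hM
  rw [norm_div, AA_norm k M hk, div_le_iff₀ hp]
  refine (norm_sum_le _ _).trans ?_
  simp only [AA_norm k _ hk]
  rw [mul_comm]
  exact head_sum k hk s.re c ρ M hM hc hσ hρ hρ1

lemma TT_bound (M k : ℕ) (hM : 2 ≤ M) (hk : 3 ≤ k) (s : ℂ) (hs : 1 < s.re) (c t : ℝ)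
    (hσ : q (M + 1) * k + c ≤ s.re)
    (ht : ∀ m, ∑ i ∈ Finset.range m, (((M + 1 : ℕ):ℝ) / (M + 1 + 1 + i : ℕ)) ^ c ≤ t) :
    ‖TT M k s‖ ≤ t := by
  unfold TT
  have hp := aa_pos k s.re (M+1) (by omega)
  have hsum := FF_summable k hk s hs
  rw [norm_div, AA_norm k _ hk, div_le_iff₀ hp, FF_eq k hk, ← hsum.sum_add_tsum_nat_add (M + 2),
    add_sub_cancel_left]
  have hs2 : Summable (fun i => ‖AA k (i + (M + 2)) s‖) := 
    ((summable_nat_add_iff (M + 2)).mpr hsum).norm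
  refine (norm_tsum_le_tsum_norm hs2).trans ?_
  apply Real.tsum_le_of_sum_range_le (fun _ => norm_nonneg _)
  intro m
  calc ∑ i ∈ Finset.range m, ‖AA k (i + (M + 2)) s‖ 
      ≤ ∑ i ∈ Finset.range m, aa k s.re (M+1) * (((M + 1 : ℕ):ℝ) / (M + 1 + 1 + i : ℕ)) ^ c := by
        apply Finset.sum_le_sum
        intro i _
        rw [AA_norm k _ hk, show i + (M + 2) = M + 1 + 1 + i by ring]
        exact tail_term k s.re c (M+1) (by omega) hσ _ (by omega)
    _ = aa k s.re (M+1) * ∑ i ∈ Finset.range m, (((M + 1 : ℕ):ℝ) / (M + 1 + 1 + i : ℕ)) ^ c := by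
        rw [Finset.mul_sum]
    _ ≤ aa k s.re (M+1) * t := by gcongr; exact ht m
    _ = _ := mul_comm _ _

lemma re_gt_one (M k : ℕ) (hM : 2 ≤ M)
    (hex : q (M + 1) * k + ((M : ℝ) + 2) * Real.log 3 <
      q M * k - ((M : ℝ) + 1) * Real.log 3)
    (s : ℂ) (h1 : q M * k - ((M : ℝ) + 1) * Real.log 3 ≤ s.re) : 1 < s.re := by
  have hl := Real.log_three_gt_d9
  have hq := q_pos (M + 1) (by omega)
  have : 0 ≤ q (M+1) * k := by positivity
  have hM' : (2:ℝ) ≤ M := by exact_mod_cast hM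
  nlinarith

lemma HT_bound (M k : ℕ) (hM : 2 ≤ M) (hk : 3 ≤ k)
    (hex : q (M + 1) * k + ((M : ℝ) + 2) * Real.log 3 <
      q M * k - ((M : ℝ) + 1) * Real.log 3)
    (s : ℂ) (h1 : q M * k - ((M : ℝ) + 1) * Real.log 3 ≤ s.re)
    (h2 : s.re ≤ q M * k + ((M : ℝ) + 1) * Real.log 3) : ∃ h t : ℝ, ‖HH M k s‖ ≤ h ∧ ‖TT M k s‖ ≤ t ∧ h < 1 ∧ t < 1 ∧
    1 / 3 ≤ (1 - h) * (1 - t) := by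
  have hs := re_gt_one M k hM hex s h1
  have hl := Real.log_three_gt_d9
  have hM' : (2:ℝ) ≤ M := by exact_mod_cast hM
  have hconv : 3 ≤ M → q M * k + (2 * M + 3) * Real.log 3 ≤ q (M - 1) * k := by
    intro hM3
    have := q_convex (M - 1) (by omega)
    rw [show M - 1 + 1 = M by omega, show M - 1 + 2 = M + 1 by omega] at this
    have h3 : (2 * q M) * k ≤ (q (M - 1) + q (M + 1)) * k := by gcongr
    nlinarith
  by_cases hcase : s.re ≤ q M * k
  · refine ⟨1/8, 13/21, ?_, ?_, by norm_num, by norm_num, by norm_num⟩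
    · have := HH_bound M k hM hk s ((2 * M + 3) * Real.log 3) (1/9) (by positivity)
        (fun h => by have := hconv h; linarith) ?_ (by norm_num)
      · refine this.trans (by norm_num)
      · rw [← exp_neg_log3']
        apply Real.exp_le_exp.mpr
        rw [neg_le_neg_iff, le_div_iff₀ (by linarith)]
        nlinarith
    · apply TT_bound M k hM hk s hs ((((M+1:ℕ):ℝ) + 1) * Real.log 3) _ _ (tail_left (M+1) (by omega))
      push_cast
      linarith
  · push Not at hcase
    refine ⟨1/2, 1/3, ?_, ?_, by norm_num, by norm_num, by norm_num⟩
    · have := HH_bound M k hM hk s ((M + 2) * Real.log 3) (1/3) (by positivity)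
        (fun h => by have := hconv h; linarith) ?_ (by norm_num)
      · refine this.trans (by norm_num)
      · rw [← exp_neg_log3]
        apply Real.exp_le_exp.mpr
        rw [neg_le_neg_iff, le_div_iff₀ (by linarith)]
        nlinarith
    · apply TT_bound M k hM hk s hs ((2 * ((M+1:ℕ):ℝ) + 1) * Real.log 3) _ _ (tail_right (M+1) (by omega))
      push_cast
      linarith

lemma HT_lt (M k : ℕ) (hM : 2 ≤ M) (hk : 3 ≤ k)
    (hex : q (M + 1) * k + ((M : ℝ) + 2) * Real.log 3 <
      q M * k - ((M : ℝ) + 1) * Real.log 3)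
    (s : ℂ) (h1 : q M * k - ((M : ℝ) + 1) * Real.log 3 ≤ s.re)
    (h2 : s.re ≤ q M * k + ((M : ℝ) + 1) * Real.log 3) : ‖HH M k s‖ < 1 ∧ ‖TT M k s‖ < 1 := by
  obtain ⟨h, t, h3, h4, h5, h6, h7⟩ := HT_bound M k hM hk hex s h1 h2
  exact ⟨by linarith, by linarith⟩

lemma HT_log (M k : ℕ) (hM : 2 ≤ M) (hk : 3 ≤ k)
    (hex : q (M + 1) * k + ((M : ℝ) + 2) * Real.log 3 <
      q M * k - ((M : ℝ) + 1) * Real.log 3)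
    (s : ℂ) (h1 : q M * k - ((M : ℝ) + 1) * Real.log 3 ≤ s.re)
    (h2 : s.re ≤ q M * k + ((M : ℝ) + 1) * Real.log 3) : ‖Complex.log (1 + TT M k s) - Complex.log (1 + HH M k s)‖ ≤ Real.log 3 := by
  obtain ⟨h, t, h3, h4, h5, h6, h7⟩ := HT_bound M k hM hk hex s h1 h2
  have e1 := norm_log_le (TT M k s) (by linarith)
  have e2 := norm_log_le (HH M k s) (by linarith)
  have e3 : Real.log (1 - t) ≤ Real.log (1 - ‖TT M k s‖) := Real.log_le_log (by linarith) (by linarith)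
  have e4 : Real.log (1 - h) ≤ Real.log (1 - ‖HH M k s‖) := Real.log_le_log (by linarith) (by linarith)
  have e5 := Real.log_le_log (by norm_num) h7
  rw [Real.log_mul (by linarith) (by linarith), one_div, Real.log_inv] at e5
  have e6 := norm_sub_le (Complex.log (1 + TT M k s)) (Complex.log (1 + HH M k s))
  linarith

lemma zero_iff (M k : ℕ) (hM : 2 ≤ M) (hk : 3 ≤ k)
    (hex : q (M + 1) * k + ((M : ℝ) + 2) * Real.log 3 <
      q M * k - ((M : ℝ) + 1) * Real.log 3)
    (s : ℂ) (h1 : q M * k - ((M : ℝ) + 1) * Real.log 3 ≤ s.re)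
    (h2 : s.re ≤ q M * k + ((M : ℝ) + 1) * Real.log 3) : iteratedDeriv k riemannZeta s = 0 ↔
    1 + HH M k s + Complex.exp (-(((Real.log ((M:ℝ) + 1) - Real.log M : ℝ) : ℂ) * (s - ((q M * k : ℝ) : ℂ))))
      * (1 + TT M k s) = 0 := by
  rw [zeta_zero_iff k s (re_gt_one M k hM hex s h1)]
  have n1 := AA_ne k M hk hM s
  have n2 := AA_ne k (M+1) hk (by omega) s
  have e := AA_succ k M hM s
  set X := Complex.exp (-(((Real.log ((M:ℝ) + 1) - Real.log M : ℝ) : ℂ) * (s - ((q M * k : ℝ) : ℂ))))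
  have key : FF k s = AA k M s * (1 + HH M k s + X * (1 + TT M k s)) := by
    have t1 : AA k M s * HH M k s = ∑ n ∈ Finset.range M, AA k n s := by
      unfold HH; field_simp
    have t2 : AA k (M+1) s * TT M k s = FF k s - ∑ n ∈ Finset.range (M + 2), AA k n s := by
      unfold TT; field_simp
    rw [Finset.sum_range_succ, Finset.sum_range_succ, ← t1] at t2
    rw [e] at t2
    linear_combination -t2
  rw [key, mul_eq_zero]
  simp [n1]

lemma HT_diff (M k : ℕ) (hM : 2 ≤ M) (hk : 3 ≤ k)
    (hex : q (M + 1) * k + ((M : ℝ) + 2) * Real.log 3 <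
      q M * k - ((M : ℝ) + 1) * Real.log 3)
    (s : ℂ) (h1 : q M * k - ((M : ℝ) + 1) * Real.log 3 ≤ s.re)
    (h2 : s.re ≤ q M * k + ((M : ℝ) + 1) * Real.log 3) : DifferentiableAt ℂ (fun s => Complex.log (1 + TT M k s) - Complex.log (1 + HH M k s)) s := by
  have hs := re_gt_one M k hM hex s h1
  obtain ⟨b1, b2⟩ := HT_lt M k hM hk hex s h1 h2
  have ho : IsOpen {s : ℂ | 1 < s.re} := isOpen_lt continuous_const Complex.continuous_re
  have dF : DifferentiableAt ℂ (FF k) s := (FF_diff k).differentiableAt (ho.mem_nhds hs)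
  have dA : ∀ n, DifferentiableAt ℂ (AA k n) s := fun n => (AA_diff k n hk) s
  have dH : DifferentiableAt ℂ (HH M k) s := by
    unfold HH
    exact (DifferentiableAt.fun_sum (fun n _ => dA n)).div (dA M) (AA_ne k M hk hM s)
  have dT : DifferentiableAt ℂ (TT M k) s := by
    unfold TT
    exact (dF.sub (DifferentiableAt.fun_sum (fun n _ => dA n))).div (dA (M+1)) (AA_ne k (M+1) hk (by omega) s)
  apply DifferentiableAt.sub
  · exact (dT.const_add 1).clog (Complex.mem_slitPlane_of_norm_lt_one b2)
  · exact (dH.const_add 1).clog (Complex.mem_slitPlane_of_norm_lt_one b1)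

lemma box (M k : ℕ) (hM : 2 ≤ M) (hk : 3 ≤ k)
    (hex : q (M + 1) * k + ((M : ℝ) + 2) * Real.log 3 <
      q M * k - ((M : ℝ) + 1) * Real.log 3) (m : ℕ) :
    ∃ s₀ : ℂ, ∀ s : ℂ, (iteratedDeriv k riemannZeta s = 0 ∧
        q M * k - ((M : ℝ) + 1) * Real.log 3 ≤ s.re ∧
        s.re ≤ q M * k + ((M : ℝ) + 1) * Real.log 3 ∧
        2 * Real.pi * m < s.im * (Real.log ((M : ℝ) + 1) - Real.log M) ∧
        s.im * (Real.log ((M : ℝ) + 1) - Real.log M) ≤ 2 * Real.pi * (m + 1)) ↔ s = s₀ := by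
  have hl := Real.log_three_gt_d9
  have hl' := Real.log_three_lt_d9
  have hpi := Real.pi_gt_three
  have hM' : (2:ℝ) ≤ M := by exact_mod_cast hM
  set L : ℝ := Real.log ((M : ℝ) + 1) - Real.log M with hL
  have hL1 : 1 < L * (M + 1) := by
    have h3 := Real.le_log_one_add_of_nonneg (by positivity : 0 ≤ 1 / (M:ℝ))
    have h4 : L = Real.log (1 + 1 / (M:ℝ)) := by
      rw [hL, ← Real.log_div (by positivity) (by positivity)]; congr 1; field_simp
    have h5 : 2 * (1 / (M:ℝ)) / (1 / (M:ℝ) + 2) = 2 / (2 * M + 1) := by field_simp; ring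
    rw [h5, ← h4] at h3
    have h6 : 1 < 2 / (2 * (M:ℝ) + 1) * (M + 1) := by
      rw [div_mul_eq_mul_div, lt_div_iff₀ (by positivity)]; linarith
    nlinarith
  have hL0 : 0 < L := by by_contra! h; nlinarith
  have hLc : (L:ℂ) ≠ 0 := by exact_mod_cast hL0.ne'
  set σ₀ : ℝ := q M * k with hσ₀
  set W : ℝ := ((M : ℝ) + 1) * Real.log 3 with hW
  have hLW : Real.log 3 < L * W := by rw [hW]; nlinarith
  set P : ℂ := ((Real.pi * (2 * m + 1) : ℝ) : ℂ) * Complex.I with hP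
  have hPre : P.re = 0 := by simp [hP]
  have hPim : P.im = Real.pi * (2 * m + 1) := by
    rw [hP, Complex.im_ofReal_mul]; simp
  have hexpP : Complex.exp P = -1 := by
    rw [show P = Real.pi * Complex.I + m * (2 * Real.pi * Complex.I) by rw [hP]; push_cast; ring,
      Complex.exp_add, Complex.exp_pi_mul_I, Complex.exp_nat_mul_two_pi_mul_I]
    simp
  -- change of variable
  let S : ℂ → ℂ := fun u => (σ₀ : ℂ) + (u + P) / L
  have hSre : ∀ u, (S u).re = σ₀ + u.re / L := by
    intro u; simp only [S]
    rw [Complex.add_re, Complex.div_ofReal_re, Complex.add_re, hPre]; simp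
  have hSim : ∀ u, (S u).im = (u.im + Real.pi * (2 * m + 1)) / L := by
    intro u; simp only [S]
    rw [Complex.add_im, Complex.div_ofReal_im, Complex.add_im, hPim]; simp
  have hstrip : ∀ u : ℂ, |u.re| ≤ L * W → σ₀ - W ≤ (S u).re ∧ (S u).re ≤ σ₀ + W := by
    intro u hu
    rw [abs_le] at hu
    rw [hSre]
    have h3 : u.re / L ≤ W := by rw [div_le_iff₀ hL0]; linarith
    have h4 : -W ≤ u.re / L := by rw [le_div_iff₀ hL0]; linarith
    constructor <;> linarith
  let G : ℂ → ℂ := fun u => Complex.log (1 + TT M k (S u)) - Complex.log (1 + HH M k (S u))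
  have hzero : ∀ u : ℂ, |u.re| ≤ L * W → 
      (iteratedDeriv k riemannZeta (S u) = 0 ↔ Complex.exp u = Complex.exp (G u)) := by
    intro u hu
    obtain ⟨h1, h2⟩ := hstrip u hu
    rw [zero_iff M k hM hk hex (S u) h1 h2]
    obtain ⟨b1, b2⟩ := HT_lt M k hM hk hex (S u) h1 h2
    have n1 : 1 + HH M k (S u) ≠ 0 := Complex.slitPlane_ne_zero (Complex.mem_slitPlane_of_norm_lt_one b1)
    have n2 : 1 + TT M k (S u) ≠ 0 := Complex.slitPlane_ne_zero (Complex.mem_slitPlane_of_norm_lt_one b2)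
    have e1 : Complex.exp (-((L:ℂ) * (S u - (σ₀:ℂ)))) = -(Complex.exp u)⁻¹ := by
      have : -((L:ℂ) * (S u - (σ₀:ℂ))) = -u + -P := by simp only [S]; field_simp; ring
      rw [this, Complex.exp_add, Complex.exp_neg, Complex.exp_neg, hexpP]
      norm_num
    rw [e1]
    simp only [G]
    rw [Complex.exp_sub, Complex.exp_log n1, Complex.exp_log n2, eq_div_iff n1]
    have n3 := Complex.exp_ne_zero u
    constructor
    · intro h
      field_simp at h
      linear_combination h
    · intro h
      field_simp
      linear_combination h
  obtain ⟨R, hR⟩ : ∃ R, R = L * W := ⟨_, rfl⟩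
  have hball : ∀ u ∈ Metric.ball (0:ℂ) R, |u.re| ≤ L * W := by
    intro u hu
    rw [mem_ball_zero_iff] at hu
    have := Complex.abs_re_le_norm u
    linarith
  have hGb : ∀ u : ℂ, |u.re| ≤ L * W → ‖G u‖ ≤ Real.log 3 := by
    intro u hu
    obtain ⟨h1, h2⟩ := hstrip u hu
    exact HT_log M k hM hk hex (S u) h1 h2
  obtain ⟨u₀, hu1, hu2, hu3⟩ := fp (Real.log 3) R (by linarith) (by linarith) G (by
      intro u hu
      obtain ⟨h1, h2⟩ := hstrip u (hball u hu)
      have hd := HT_diff M k hM hk hex (S u) h1 h2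
      have hS : DifferentiableAt ℂ S u := by
        simp only [S]; fun_prop
      exact (hd.comp u hS).differentiableWithinAt) (fun u hu => hGb u (hball u hu))
  refine ⟨S u₀, fun s => ⟨?_, ?_⟩⟩
  · rintro ⟨z, h1, h2, h3, h4⟩
    obtain ⟨u, hu⟩ : ∃ u, u = (L:ℂ) * (s - σ₀) - P := ⟨_, rfl⟩
    have hSu : S u = s := by simp only [S]; rw [hu]; field_simp; ring
    have hre : (S u).re = σ₀ + u.re / L := hSre u
    have him : (S u).im = (u.im + Real.pi * (2 * m + 1)) / L := hSim u
    rw [hSu] at hre him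
    have hure : |u.re| ≤ L * W := by
      have : u.re = L * (s.re - σ₀) := by rw [hre]; field_simp; ring
      rw [this, abs_le]
      constructor <;> nlinarith
    have huim : u.im = s.im * L - Real.pi * (2 * m + 1) := by rw [him]; field_simp; ring
    rw [← hSu] at z
    have hexp := (hzero u hure).mp z
    have hGu := hGb u hure
    rw [Complex.exp_eq_exp_iff_exists_int] at hexp
    obtain ⟨n, hn⟩ := hexp
    have hGim := (Complex.abs_im_le_norm (G u)).trans hGu
    rw [abs_le] at hGim
    have hnim : u.im = (G u).im + n * (2 * Real.pi) := by
      have := congrArg Complex.im hn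
      rw [this]; simp
    have hn1 : n < 1 := by
      by_contra! hcon
      have : (1:ℝ) ≤ n := by exact_mod_cast hcon
      nlinarith
    have hn2 : -1 < n := by
      by_contra! hcon
      have : (n:ℝ) ≤ -1 := by exact_mod_cast hcon
      nlinarith
    have hn0 : n = 0 := by omega
    have hfix : G u = u := by
      rw [hn0] at hn
      simpa using hn.symm
    have : u = u₀ := by
      apply hu3 u _ hfix
      rw [mem_ball_zero_iff, ← hfix]; linarith
    rw [← this, hSu]
  · rintro rfl
    have hre0 : |u₀.re| ≤ L * W := by
      have := Complex.abs_re_le_norm u₀; linarith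
    obtain ⟨h1, h2⟩ := hstrip u₀ hre0
    refine ⟨(hzero u₀ hre0).mpr (congrArg Complex.exp hu2.symm), h1, h2, ?_⟩
    have him := (Complex.abs_im_le_norm u₀).trans hu1
    rw [abs_le] at him
    rw [hSim, div_mul_cancel₀ _ hL0.ne']
    constructor
    · linarith [him.1]
    · linarith [him.2]

/-- If the critical strip `S_M^k` exists, then for every `j ≥ 1` the number of zeros of
the `k`-th derivative of the Riemann zeta function in `S_M^k` with
`0 < Im s ≤ 2πj/(log(M+1)-log M)` is exactly `j`. -/
theorem zeta_deriv_zero_count_in_strip (M k : ℕ) (hM : 2 ≤ M) (hk : 3 ≤ k)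
    (hex : q (M + 1) * k + ((M : ℝ) + 2) * Real.log 3 <
      q M * k - ((M : ℝ) + 1) * Real.log 3)
    (j : ℕ) (hj : 1 ≤ j) :
    {s : ℂ | iteratedDeriv k riemannZeta s = 0 ∧
        q M * k - ((M : ℝ) + 1) * Real.log 3 ≤ s.re ∧
        s.re ≤ q M * k + ((M : ℝ) + 1) * Real.log 3 ∧
        0 < s.im ∧
        s.im ≤ 2 * Real.pi * j / (Real.log ((M : ℝ) + 1) - Real.log M)}.Finite ∧
    {s : ℂ | iteratedDeriv k riemannZeta s = 0 ∧
        q M * k - ((M : ℝ) + 1) * Real.log 3 ≤ s.re ∧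
        s.re ≤ q M * k + ((M : ℝ) + 1) * Real.log 3 ∧
        0 < s.im ∧
        s.im ≤ 2 * Real.pi * j / (Real.log ((M : ℝ) + 1) - Real.log M)}.ncard = j := by
  have hL0 : 0 < Real.log ((M : ℝ) + 1) - Real.log M := by
    have := log_lt_succ M hM; linarith
  have hpi := Real.pi_pos
  choose z hz using box M k hM hk hex
  set L : ℝ := Real.log ((M : ℝ) + 1) - Real.log M with hL
  have hzm := fun m => (hz m (z m)).mpr rfl
  have hinj : Function.Injective z := by
    intro a b hab
    obtain ⟨-, -, -, a1, a2⟩ := hzm a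
    obtain ⟨-, -, -, b1, b2⟩ := hzm b
    rw [hab] at a1 a2
    have c1 : 2 * Real.pi * a < 2 * Real.pi * (b + 1) := by linarith
    have c2 : 2 * Real.pi * b < 2 * Real.pi * (a + 1) := by linarith
    have d1 : (a:ℝ) < b + 1 := lt_of_mul_lt_mul_left c1 (by positivity)
    have d2 : (b:ℝ) < a + 1 := lt_of_mul_lt_mul_left c2 (by positivity)
    have d3 : a < b + 1 := by exact_mod_cast d1
    have d4 : b < a + 1 := by exact_mod_cast d2
    omega
  have hset : {s : ℂ | iteratedDeriv k riemannZeta s = 0 ∧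
        q M * k - ((M : ℝ) + 1) * Real.log 3 ≤ s.re ∧
        s.re ≤ q M * k + ((M : ℝ) + 1) * Real.log 3 ∧
        0 < s.im ∧
        s.im ≤ 2 * Real.pi * j / L} = ((Finset.range j).image z : Finset ℂ) := by
    ext s
    simp only [Set.mem_ofPred_eq, Finset.coe_image, Set.mem_image, Finset.mem_coe, Finset.mem_range]
    constructor
    · rintro ⟨h1, h2, h3, h4, h5⟩
      rw [le_div_iff₀ hL0] at h5
      have hx : 0 < s.im * L / (2 * Real.pi) := by positivity
      set x := s.im * L / (2 * Real.pi) with hxd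
      have hxe : s.im * L = 2 * Real.pi * x := by rw [hxd]; field_simp
      have hc1 := Nat.ceil_lt_add_one hx.le
      have hc2 := Nat.le_ceil x
      have hc3 : 0 < ⌈x⌉₊ := Nat.ceil_pos.mpr hx
      have hxj : x ≤ j := by
        rw [hxe] at h5
        exact le_of_mul_le_mul_left h5 (by positivity)
      have hc4 : ⌈x⌉₊ ≤ j := Nat.ceil_le.mpr hxj
      obtain ⟨m, hm⟩ : ∃ m, ⌈x⌉₊ = m + 1 := ⟨⌈x⌉₊ - 1, by omega⟩
      rw [hm] at hc1 hc2 hc4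
      push_cast at hc1 hc2
      refine ⟨m, by omega, ((hz m s).mp ⟨h1, h2, h3, ?_, ?_⟩).symm⟩
      · rw [hxe]
        have : (m:ℝ) < x := by linarith
        gcongr
      · rw [hxe]; gcongr
    · rintro ⟨m, hm, rfl⟩
      obtain ⟨h1, h2, h3, h4, h5⟩ := hzm m
      refine ⟨h1, h2, h3, ?_, ?_⟩
      · have : 0 < (z m).im * L := lt_of_le_of_lt (by positivity) h4
        exact pos_of_mul_pos_left this hL0.le
      · rw [le_div_iff₀ hL0]
        refine h5.trans ?_
        have : (m:ℝ) + 1 ≤ j := by exact_mod_cast hm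
        gcongr
  rw [hset]
  refine ⟨Finset.finite_toSet _, ?_⟩
  rw [Set.ncard_coe_finset, Finset.card_image_of_injective _ hinj, Finset.card_range]
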